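/- Let f be an exact area-preserving twist map of the annulus 𝕋 × ℝ and let T ⊂ 𝕋 × ℝ be an essential topological circle invariant under f. Then T is the graph of a Lipschitz function ψ : 𝕋 → ℝ, i.e. T = {(θ, ψ(θ)) : θ ∈ 𝕋} with ψ Lipschitz. -/

import Mathlib

/-!
STATEMENT 1 (Birkhoff's theorem: an essential topological circle invariant
under an exact area-preserving twist map of the annulus 𝕋 × ℝ is the graph of
a Lipschitz function ψ : 𝕋 → ℝ).

We work on the universal cover ℝ² of the annulus.  An exact area-preserving
twist map is given by a smooth generating function `h : ℝ² → ℝ`, 1-periodic in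
the first variable, whose associated lift `F : ℝ² → ℝ²`, `F (θ, I) = (Θ, 𝓘)`,
is defined implicitly by `𝓘 = I - ∂_θ h (θ, 𝓘)` and `Θ = θ + ∂_𝓘 h (θ, 𝓘)`,
and which satisfies the twist condition (a1) and the condition (a2) at infinity.

An (essential topological) invariant circle is described by its lift
`T ⊆ ℝ²`, parametrized by a continuous injective `Γ : ℝ → ℝ²` with
`Γ (x + 1) = Γ x + (1, 0)`.  Upstairs, "T is the graph of a Lipschitz
function ψ : 𝕋 → ℝ" reads: `T = {(x, ψ x) : x ∈ ℝ}` for a Lipschitz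
1-periodic `ψ : ℝ → ℝ`.
-/

/-- The data and axioms of an exact area-preserving twist map of the annulus
`𝕋 × ℝ`, given by its lift `F` to the universal cover `ℝ²` together with its
generating function `h`. -/
structure TwistMap where
  /-- the generating function, as a function of `(θ, 𝓘)` -/
  h : ℝ → ℝ → ℝ
  /-- the lift of the twist map to the universal cover `ℝ²` -/
  F : ℝ × ℝ → ℝ × ℝ
  smooth_h : ContDiff ℝ (⊤ : ℕ∞) (Function.uncurry h)
  periodic_h : ∀ θ I, h (θ + 1) I = h θ I
  smooth_F : ContDiff ℝ (⊤ : ℕ∞) F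
  bijective_F : Function.Bijective F
  periodic_F : ∀ θ I, F (θ + 1, I) = F (θ, I) + (1, 0)
  /-- `𝓘 = I - ∂_θ h (θ, 𝓘)` -/
  gen_snd : ∀ θ I, (F (θ, I)).2 = I - deriv (fun t => h t (F (θ, I)).2) θ
  /-- `Θ = θ + ∂_𝓘 h (θ, 𝓘)` -/
  gen_fst : ∀ θ I, (F (θ, I)).1 = θ + deriv (fun J => h θ J) (F (θ, I)).2
  /-- (a1): the twist condition `∂_I Θ (θ, I) > 0` -/
  twist : ∀ θ I, 0 < deriv (fun J => (F (θ, J)).1) I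
  /-- (a2): `|Θ| → +∞` as `|I| → +∞`, uniformly in `θ` (on the annulus, i.e.
  for `θ` in a fundamental domain). -/
  infinity : ∀ C : ℝ, 0 < C → ∃ R : ℝ, 0 < R ∧
    ∀ θ ∈ Set.Icc (0:ℝ) 1, ∀ I : ℝ, R ≤ |I| → C ≤ |(F (θ, I)).1|

/-- `Γ : ℝ → ℝ²` is the lift of a parametrization of an essential topological
circle in the annulus `𝕋 × ℝ` : it is continuous, injective (equivalently, the
induced map of the circle `𝕋` into the annulus is injective) and commutes with
the deck transformation. -/
def IsEssentialCircleParam (Γ : ℝ → ℝ × ℝ) : Prop :=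
  Continuous Γ ∧ Function.Injective Γ ∧ ∀ x, Γ (x + 1) = Γ x + (1, 0)

/-- `T ⊆ ℝ²` is the lift of an essential topological circle in the annulus. -/
def IsEssentialCircle (T : Set (ℝ × ℝ)) : Prop :=
  ∃ Γ : ℝ → ℝ × ℝ, IsEssentialCircleParam Γ ∧ Set.range Γ = T

namespace TwistMap

variable (f : TwistMap)

/-- The partial derivative of the generating function in the direction `v`. -/
noncomputable def dh (v p : ℝ × ℝ) : ℝ := fderiv ℝ (Function.uncurry f.h) p v

lemma contDiff_dh (v : ℝ × ℝ) : ContDiff ℝ 1 (f.dh v) := by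
  have h : ContDiff ℝ 2 (Function.uncurry f.h) := contDiff_infty.1 f.smooth_h 2
  have h' : ContDiff ℝ 1 (fderiv ℝ (Function.uncurry f.h)) :=
    h.fderiv_right (by norm_num)
  exact h'.clm_apply contDiff_const

lemma differentiable_h : Differentiable ℝ (Function.uncurry f.h) :=
  f.smooth_h.differentiable (by simp)

lemma hasDerivAt_h_fst (θ J : ℝ) : HasDerivAt (fun t => f.h t J) (f.dh (1, 0) (θ, J)) θ := by
  have h1 : HasDerivAt (fun t : ℝ => (t, J)) ((1 : ℝ), (0 : ℝ)) θ :=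
    (hasDerivAt_id θ).prodMk (hasDerivAt_const θ J)
  exact (f.differentiable_h (θ, J)).hasFDerivAt.comp_hasDerivAt θ h1

lemma hasDerivAt_h_snd (θ J : ℝ) : HasDerivAt (fun t => f.h θ t) (f.dh (0, 1) (θ, J)) J := by
  have h1 : HasDerivAt (fun t : ℝ => (θ, t)) ((0 : ℝ), (1 : ℝ)) J :=
    (hasDerivAt_const J θ).prodMk (hasDerivAt_id J)
  exact (f.differentiable_h (θ, J)).hasFDerivAt.comp_hasDerivAt J h1

lemma F_snd_add (p : ℝ × ℝ) : (f.F p).2 + f.dh (1, 0) (p.1, (f.F p).2) = p.2 := by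
  have := f.gen_snd p.1 p.2
  rw [(f.hasDerivAt_h_fst _ _).deriv] at this
  simp only [Prod.mk.eta] at this
  linarith

lemma F_fst_eq (p : ℝ × ℝ) : (f.F p).1 = p.1 + f.dh (0, 1) (p.1, (f.F p).2) := by
  have := f.gen_fst p.1 p.2
  rw [(f.hasDerivAt_h_snd _ _).deriv] at this
  simpa only [Prod.mk.eta] using this

lemma contDiff_F : ContDiff ℝ 1 f.F := f.smooth_F.of_le (by exact_mod_cast le_top)

lemma hasFDerivAt_F (p : ℝ × ℝ) : HasFDerivAt f.F (fderiv ℝ f.F p) p :=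
  (f.contDiff_F.differentiable (by simp) p).hasFDerivAt

lemma twist_pos (p : ℝ × ℝ) : 0 < (fderiv ℝ f.F p (0, 1)).1 := by
  have h := f.twist p.1 p.2
  have h1 : HasDerivAt (fun t : ℝ => (p.1, t)) ((0 : ℝ), (1 : ℝ)) p.2 :=
    (hasDerivAt_const p.2 p.1).prodMk (hasDerivAt_id p.2)
  have h2 : HasDerivAt (fun t : ℝ => f.F (p.1, t)) (fderiv ℝ f.F p (0, 1)) p.2 :=
    (f.hasFDerivAt_F p).comp_hasDerivAt p.2 h1
  have h3 : HasDerivAt (fun t : ℝ => (f.F (p.1, t)).1) (fderiv ℝ f.F p (0, 1)).1 p.2 := by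
    have := (hasFDerivAt_fst (𝕜 := ℝ) (p := f.F (p.1, p.2))).comp_hasDerivAt p.2 h2
    exact this
  rwa [h3.deriv] at h

lemma fderiv_dh (v w p : ℝ × ℝ) : fderiv ℝ (f.dh v) p w =
    fderiv ℝ (fderiv ℝ (Function.uncurry f.h)) p w v := by
  have h : ContDiff ℝ 2 (Function.uncurry f.h) := contDiff_infty.1 f.smooth_h 2
  have h' : DifferentiableAt ℝ (fderiv ℝ (Function.uncurry f.h)) p :=
    (h.fderiv_right (m := 1) (by norm_num)).differentiable (by simp) p
  have := (h'.hasFDerivAt.clm_apply (hasFDerivAt_const v p)).fderiv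
  unfold dh
  rw [this]
  simp

/-- Differentiating the implicit equations of the generating function: the entries of the
Jacobian matrix of `F` in terms of the second derivatives of `h`. -/
lemma fderiv_relations (p : ℝ × ℝ) : ∃ a b d : ℝ, ∀ v : ℝ × ℝ,
    (fderiv ℝ f.F p v).2 + (v.1 * a + (fderiv ℝ f.F p v).2 * b) = v.2 ∧
    (fderiv ℝ f.F p v).1 = v.1 + (v.1 * b + (fderiv ℝ f.F p v).2 * d) := by
  set m : ℝ × ℝ := (p.1, (f.F p).2) with hm
  have hsym : fderiv ℝ (f.dh (0, 1)) m (1, 0) = fderiv ℝ (f.dh (1, 0)) m (0, 1) := by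
    rw [fderiv_dh, fderiv_dh]
    have : ContDiffAt ℝ 2 (Function.uncurry f.h) m :=
      (contDiff_infty.1 f.smooth_h 2).contDiffAt
    exact (this.isSymmSndFDerivAt (by simp)).eq _ _
  refine ⟨fderiv ℝ (f.dh (1, 0)) m (1, 0), fderiv ℝ (f.dh (1, 0)) m (0, 1),
    fderiv ℝ (f.dh (0, 1)) m (0, 1), fun v => ?_⟩
  have hsplit : ∀ (M : ℝ × ℝ →L[ℝ] ℝ) (w : ℝ × ℝ), M w = w.1 * M (1, 0) + w.2 * M (0, 1) := by
    intro M w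
    have : w = w.1 • ((1 : ℝ), (0 : ℝ)) + w.2 • ((0 : ℝ), (1 : ℝ)) := by ext <;> simp
    conv_lhs => rw [this]
    rw [map_add, map_smul, map_smul, smul_eq_mul, smul_eq_mul]
  have hF := f.hasFDerivAt_F p
  have hF2 := (hasFDerivAt_snd (p := f.F p)).comp p hF
  have hF1 := (hasFDerivAt_fst (p := f.F p)).comp p hF
  have hmm : HasFDerivAt (fun p : ℝ × ℝ => (p.1, (f.F p).2)) _ p := hasFDerivAt_fst.prodMk hF2
  have hd : ∀ v, HasFDerivAt (f.dh v) (fderiv ℝ (f.dh v) m) m := fun v =>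
    ((f.contDiff_dh v).differentiable (by simp) m).hasFDerivAt
  have e1 := hF2.add ((hd (1, 0)).comp p hmm)
  have e2 := hasFDerivAt_fst.add ((hd (0, 1)).comp p hmm)
  have i1 := e1.unique (hasFDerivAt_snd.congr_of_eventuallyEq
    (Filter.Eventually.of_forall fun q => f.F_snd_add q))
  have i2 := e2.unique (hF1.congr_of_eventuallyEq
    (Filter.Eventually.of_forall fun q => (f.F_fst_eq q).symm))
  have j1 := congrArg (fun M : ℝ × ℝ →L[ℝ] ℝ => M v) i1
  have j2 := congrArg (fun M : ℝ × ℝ →L[ℝ] ℝ => M v) i2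
  simp only [add_apply, ContinuousLinearMap.comp_apply,
    ContinuousLinearMap.coe_fst', ContinuousLinearMap.coe_snd',
    ContinuousLinearMap.prod_apply] at j1 j2
  rw [hsplit] at j1 j2
  rw [hsym] at j2
  exact ⟨j1, j2.symm⟩

lemma jacobian_eq_one (p : ℝ × ℝ) :
    (fderiv ℝ f.F p (1, 0)).1 * (fderiv ℝ f.F p (0, 1)).2 -
      (fderiv ℝ f.F p (0, 1)).1 * (fderiv ℝ f.F p (1, 0)).2 = 1 := by
  obtain ⟨a, b, d, h⟩ := f.fderiv_relations p
  obtain ⟨h1, h2⟩ := h (1, 0)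
  obtain ⟨h3, h4⟩ := h (0, 1)
  simp only at h1 h2 h3 h4
  rw [h2, h4]
  linear_combination h3

lemma fderiv_snd_ne_zero (p : ℝ × ℝ) : (fderiv ℝ f.F p (0, 1)).2 ≠ 0 := by
  obtain ⟨a, b, d, h⟩ := f.fderiv_relations p
  intro h0
  have := (h (0, 1)).1
  rw [h0] at this
  simp at this

lemma det_fderiv (p : ℝ × ℝ) : (fderiv ℝ f.F p).det = 1 := by
  rw [ContinuousLinearMap.det, ← LinearMap.det_toMatrix (Module.Basis.finTwoProd ℝ),
    Matrix.det_fin_two]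
  simp only [LinearMap.toMatrix_apply, Module.Basis.finTwoProd_zero,
    Module.Basis.finTwoProd_one, Module.Basis.coe_finTwoProd_repr]
  simpa using f.jacobian_eq_one p

/-- `F` as a homeomorphism of the plane. -/
noncomputable def homeo : (ℝ × ℝ) ≃ₜ (ℝ × ℝ) :=
  (Equiv.ofBijective f.F f.bijective_F).toHomeomorphOfContinuousOpen f.smooth_F.continuous
    (isOpenMap_iff_nhds_le.2 fun p => by
      have h1 : HasStrictFDerivAt f.F (((fderiv ℝ f.F p).toContinuousLinearEquivOfDetNeZero
          (by rw [f.det_fderiv]; exact one_ne_zero) : (ℝ × ℝ) ≃L[ℝ] (ℝ × ℝ)) :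
          ℝ × ℝ →L[ℝ] ℝ × ℝ) p := by
        rw [ContinuousLinearMap.coe_toContinuousLinearEquivOfDetNeZero]
        exact f.contDiff_F.contDiffAt.hasStrictFDerivAt (by simp)
      exact h1.map_nhds_eq_of_equiv.ge)

lemma homeo_apply (p : ℝ × ℝ) : f.homeo p = f.F p := rfl

lemma contDiff_homeo : ContDiff ℝ 1 f.homeo := f.contDiff_F

lemma contDiff_homeo_symm : ContDiff ℝ 1 f.homeo.symm := by
  refine f.homeo.contDiff_symm (f₀' := fun p =>
    (fderiv ℝ f.F p).toContinuousLinearEquivOfDetNeZero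
      (by rw [f.det_fderiv]; exact one_ne_zero)) (fun p => ?_) f.contDiff_F
  rw [ContinuousLinearMap.coe_toContinuousLinearEquivOfDetNeZero]
  exact f.hasFDerivAt_F p

lemma fderiv_homeo_symm_neg (p : ℝ × ℝ) : (fderiv ℝ f.homeo.symm p (0, 1)).1 < 0 := by
  set q := f.homeo.symm p with hq
  have hsplit : ∀ (M : ℝ × ℝ →L[ℝ] ℝ × ℝ) (w : ℝ × ℝ),
      M w = w.1 • M (1, 0) + w.2 • M (0, 1) := by
    intro M w
    have : w = w.1 • ((1 : ℝ), (0 : ℝ)) + w.2 • ((0 : ℝ), (1 : ℝ)) := by ext <;> simp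
    conv_lhs => rw [this]
    rw [map_add, map_smul, map_smul]
  have h1 : HasFDerivAt f.homeo.symm (fderiv ℝ f.homeo.symm p) p :=
    (f.contDiff_homeo_symm.differentiable (by simp) p).hasFDerivAt
  have h2 := (f.hasFDerivAt_F q).comp p h1
  have h3 := h2.unique ((hasFDerivAt_id p).congr_of_eventuallyEq
    (Filter.Eventually.of_forall fun z => f.homeo.apply_symm_apply z))
  have h4 := congrArg (fun M : ℝ × ℝ →L[ℝ] ℝ × ℝ => M (0, 1)) h3
  simp only [ContinuousLinearMap.comp_apply, ContinuousLinearMap.id_apply] at h4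
  rw [hsplit] at h4
  have h5 := congrArg Prod.fst h4
  have h6 := congrArg Prod.snd h4
  simp at h5 h6
  have hj := f.jacobian_eq_one q
  have ht := f.twist_pos q
  have hx : (fderiv ℝ f.homeo.symm p (0, 1)).1 = -(fderiv ℝ f.F q (0, 1)).1 := by
    linear_combination (fderiv ℝ f.F q (0, 1)).2 * h5 - (fderiv ℝ f.F q (0, 1)).1 * h6
      - (fderiv ℝ f.homeo.symm p (0, 1)).1 * hj
  linarith

lemma F_fst_lt {p q : ℝ × ℝ} (h1 : p.1 = q.1) (h2 : p.2 < q.2) : (f.F p).1 < (f.F q).1 := by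
  have := strictMono_of_deriv_pos (f.twist p.1) h2
  simp only [Prod.mk.eta] at this
  rwa [show (p.1, q.2) = q by rw [h1]] at this

lemma homeo_symm_fst_lt {p q : ℝ × ℝ} (h1 : p.1 = q.1) (h2 : p.2 < q.2) :
    (f.homeo.symm q).1 < (f.homeo.symm p).1 := by
  have hd : ∀ t : ℝ, HasDerivAt (fun t : ℝ => (f.homeo.symm (p.1, t)).1)
      (fderiv ℝ f.homeo.symm (p.1, t) (0, 1)).1 t := by
    intro t
    have h1 : HasDerivAt (fun t : ℝ => (p.1, t)) ((0 : ℝ), (1 : ℝ)) t :=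
      (hasDerivAt_const t p.1).prodMk (hasDerivAt_id t)
    have h3 : HasFDerivAt f.homeo.symm (fderiv ℝ f.homeo.symm (p.1, t)) (p.1, t) :=
      (f.contDiff_homeo_symm.differentiable (by simp) _).hasFDerivAt
    exact (hasFDerivAt_fst (p := f.homeo.symm (p.1, t))).comp_hasDerivAt t (h3.comp_hasDerivAt t h1)
  have := strictAnti_of_deriv_neg
    (fun t => by rw [(hd t).deriv]; exact f.fderiv_homeo_symm_neg _) h2
  simp only [Prod.mk.eta] at this
  rwa [show (p.1, q.2) = q by rw [h1]] at this

lemma F_add (p : ℝ × ℝ) : f.F (p + (1, 0)) = f.F p + (1, 0) := by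
  rw [← f.periodic_F p.1 p.2]
  congr 1
  ext <;> simp

lemma homeo_symm_add (p : ℝ × ℝ) : f.homeo.symm (p + (1, 0)) = f.homeo.symm p + (1, 0) := by
  rw [Homeomorph.symm_apply_eq, homeo_apply, F_add, ← homeo_apply, Homeomorph.apply_symm_apply]

end TwistMap

namespace TwistMap

variable (f : TwistMap)

lemma hasStrictDerivAt_snd (θ I : ℝ) :
    HasStrictDerivAt (fun t : ℝ => (f.F (θ, t)).2) (fderiv ℝ f.F (θ, I) (0, 1)).2 I := by
  have h1 : HasStrictDerivAt (fun t : ℝ => (θ, t)) ((0 : ℝ), (1 : ℝ)) I :=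
    (hasStrictDerivAt_const I θ).prodMk (hasStrictDerivAt_id I)
  have h2 : HasStrictDerivAt (fun t : ℝ => f.F (θ, t)) (fderiv ℝ f.F (θ, I) (0, 1)) I :=
    (f.contDiff_F.contDiffAt.hasStrictFDerivAt (by simp)).comp_hasStrictDerivAt I h1
  have := (hasStrictFDerivAt_snd (𝕜 := ℝ) (p := f.F (θ, I))).comp_hasStrictDerivAt I h2
  exact this

lemma F_snd_section (θ J : ℝ) : (f.F (θ, J + f.dh (1, 0) (θ, J))).2 = J := by
  set S : Set ℝ := {J | (f.F (θ, J + f.dh (1, 0) (θ, J))).2 = J} with hS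
  have hSr : S = Set.range (fun I => (f.F (θ, I)).2) := by
    ext J
    constructor
    · intro h
      exact ⟨_, h⟩
    · rintro ⟨I, rfl⟩
      have := f.F_snd_add (θ, I)
      simp only [hS, Set.mem_ofPred_eq]
      simp only at this
      rw [this]
  have hopen : IsOpen S := by
    rw [hSr, ← Set.image_univ]
    exact (isOpenMap_of_hasStrictDerivAt (fun I => f.hasStrictDerivAt_snd θ I)
      (fun I => f.fderiv_snd_ne_zero _)) _ isOpen_univ
  have hclosed : IsClosed S := by
    have h1 := f.smooth_F.continuous
    have h2 := (f.contDiff_dh (1, 0)).continuous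
    exact isClosed_eq (by fun_prop) (by fun_prop)
  have huniv : S = Set.univ :=
    IsClopen.eq_univ ⟨hclosed, hopen⟩ (hSr ▸ Set.range_nonempty _)
  exact (huniv ▸ Set.mem_univ J : J ∈ S)

lemma fderiv_snd_pos (p : ℝ × ℝ) : 0 < (fderiv ℝ f.F p (0, 1)).2 := by
  have hc : Continuous fun p => (fderiv ℝ f.F p (0, 1)).2 :=
    ((f.contDiff_F.continuous_fderiv (by simp)).clm_apply continuous_const).snd
  by_contra! hneg
  have hall : ∀ q, (fderiv ℝ f.F q (0, 1)).2 < 0 := by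
    intro q
    by_contra! hq
    obtain ⟨r, -, hr⟩ := isPreconnected_univ.intermediate_value (Set.mem_univ p)
      (Set.mem_univ q) hc.continuousOn ⟨hneg, hq⟩
    exact f.fderiv_snd_ne_zero r hr
  have hd : ∀ θ, HasDerivAt (fun t => f.h t 1 - f.h t 0)
      (f.dh (1, 0) (θ, 1) - f.dh (1, 0) (θ, 0)) θ := fun θ =>
    (f.hasDerivAt_h_fst θ 1).sub (f.hasDerivAt_h_fst θ 0)
  obtain ⟨θ, -, hθ⟩ := exists_deriv_eq_zero (f := fun t => f.h t 1 - f.h t 0) zero_lt_one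
    (fun t _ => (hd t).continuousAt.continuousWithinAt) (by
      have := f.periodic_h 0 1
      have := f.periodic_h 0 0
      simp_all)
  rw [(hd θ).deriv] at hθ
  have hanti : StrictAnti fun t : ℝ => (f.F (θ, t)).2 :=
    strictAnti_of_deriv_neg fun t => by
      rw [(f.hasStrictDerivAt_snd θ t).hasDerivAt.deriv]; exact hall _
  have h1 := f.F_snd_section θ 1
  have h0 := f.F_snd_section θ 0
  have := hanti (show 0 + f.dh (1, 0) (θ, 0) < 1 + f.dh (1, 0) (θ, 1) by linarith)
  simp only at this
  linarith

lemma F_snd_le_iff (p : ℝ × ℝ) (b : ℝ) :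
    (f.F p).2 ≤ b ↔ p.2 ≤ b + f.dh (1, 0) (p.1, b) := by
  have hmono : StrictMono fun t : ℝ => (f.F (p.1, t)).2 :=
    strictMono_of_deriv_pos fun t => by
      rw [(f.hasStrictDerivAt_snd _ t).hasDerivAt.deriv]; exact f.fderiv_snd_pos _
  have h := hmono.le_iff_le (a := p.2) (b := b + f.dh (1, 0) (p.1, b))
  simp only [F_snd_section] at h
  exact h

end TwistMap

/-- The points lying strictly below every point of `T` on the same vertical. -/
def belowSet (T : Set (ℝ × ℝ)) : Set (ℝ × ℝ) := {p | ∀ q ∈ T, q.1 = p.1 → p.2 < q.2}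

/-- The points lying strictly above every point of `T` on the same vertical. -/
def aboveSet (T : Set (ℝ × ℝ)) : Set (ℝ × ℝ) := {p | ∀ q ∈ T, q.1 = p.1 → q.2 < p.2}

section Degree

open Filter

variable {g : ℝ → ℝ}

lemma add_intCast_of_add_one (hg : ∀ x, g (x + 1) = g x + 1) (x : ℝ) (n : ℤ) :
    g (x + n) = g x + n := by
  induction n using Int.induction_on with
  | zero => simp
  | succ n ih => push_cast at *; rw [← add_assoc, hg, ih]; ring
  | pred n ih =>
    push_cast at *
    have := hg (x + (-n - 1))
    rw [show x + (-(n : ℝ) - 1) + 1 = x + -n by ring, ih] at this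
    linarith

lemma exists_abs_sub_le_of_add_one (hc : Continuous g) (hg : ∀ x, g (x + 1) = g x + 1) :
    ∃ C, ∀ x, |g x - x| ≤ C := by
  obtain ⟨C, hC⟩ := (isCompact_Icc (a := (0 : ℝ)) (b := 1)).exists_bound_of_continuousOn
    (f := fun x => g x - x) (by fun_prop)
  refine ⟨C, fun x => ?_⟩
  have h := hC (Int.fract x) ⟨Int.fract_nonneg x, (Int.fract_lt_one x).le⟩
  have h2 := add_intCast_of_add_one hg (Int.fract x) ⌊x⌋
  rw [Int.fract_add_floor] at h2
  rw [Real.norm_eq_abs] at h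
  rw [h2]
  have h3 := Int.fract_add_floor x
  rwa [show g (Int.fract x) + ⌊x⌋ - x = g (Int.fract x) - Int.fract x by linarith]

lemma tendsto_atTop_of_add_one (hc : Continuous g) (hg : ∀ x, g (x + 1) = g x + 1) :
    Tendsto g atTop atTop := by
  obtain ⟨C, hC⟩ := exists_abs_sub_le_of_add_one hc hg
  refine tendsto_atTop_mono (f := fun x => x - C) (fun x => ?_)
    (tendsto_atTop_add_const_right _ _ tendsto_id)
  have := (abs_le.1 (hC x)).1
  linarith

lemma tendsto_atBot_of_add_one (hc : Continuous g) (hg : ∀ x, g (x + 1) = g x + 1) :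
    Tendsto g atBot atBot := by
  obtain ⟨C, hC⟩ := exists_abs_sub_le_of_add_one hc hg
  refine tendsto_atBot_mono (f := fun x => x + C) (fun x => ?_)
    (tendsto_atBot_add_const_right _ _ tendsto_id)
  have := (abs_le.1 (hC x)).2
  linarith

lemma surjective_of_add_one (hc : Continuous g) (hg : ∀ x, g (x + 1) = g x + 1) :
    Function.Surjective g :=
  hc.surjective (tendsto_atTop_of_add_one hc hg) (tendsto_atBot_of_add_one hc hg)

end Degree

section Crossing

open Filter Topology

/-- A homeomorphism of the plane that commutes with the unit horizontal translation and tilts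
vertical lines to the right, its inverse tilting them to the left. -/
structure IsTilting (F : (ℝ × ℝ) ≃ₜ (ℝ × ℝ)) : Prop where
  map_add : ∀ p, F (p + (1, 0)) = F p + (1, 0)
  fst_lt : ∀ p q, p.1 = q.1 → p.2 < q.2 → (F p).1 < (F q).1
  symm_fst_lt : ∀ p q, p.1 = q.1 → p.2 < q.2 → (F.symm q).1 < (F.symm p).1

variable {F : (ℝ × ℝ) ≃ₜ (ℝ × ℝ)} {T : Set (ℝ × ℝ)} {Γ : ℝ → ℝ × ℝ}

lemma IsTilting.iterate_add (hF : IsTilting F) (n : ℕ) (p : ℝ × ℝ) :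
    F^[n] (p + (1, 0)) = F^[n] p + (1, 0) := by
  induction n generalizing p with
  | zero => rfl
  | succ n ih => rw [Function.iterate_succ_apply, hF.map_add, ih, ← Function.iterate_succ_apply]

lemma iterate_mem_iff (hT : ∀ p, F p ∈ T ↔ p ∈ T) (n : ℕ) (p : ℝ × ℝ) :
    F^[n] p ∈ T ↔ p ∈ T := by
  induction n generalizing p with
  | zero => rfl
  | succ n ih => rw [Function.iterate_succ_apply, ih, hT]

lemma IsTilting.lt_succ (hF : IsTilting F) {u v : ℝ × ℝ} {n : ℕ}
    (h1 : (F^[n] u).1 = (F^[n] v).1) (h2 : (F^[n] u).2 < (F^[n] v).2) :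
    (F^[n + 1] u).1 < (F^[n + 1] v).1 := by
  rw [Function.iterate_succ_apply', Function.iterate_succ_apply']
  exact hF.fst_lt _ _ h1 h2

lemma IsTilting.lt_pred (hF : IsTilting F) {u v : ℝ × ℝ} {n : ℕ}
    (h1 : (F^[n + 1] u).1 = (F^[n + 1] v).1) (h2 : (F^[n + 1] u).2 < (F^[n + 1] v).2) :
    (F^[n] v).1 < (F^[n] u).1 := by
  have := hF.symm_fst_lt _ _ h1 h2
  rwa [Function.iterate_succ_apply', Function.iterate_succ_apply', F.symm_apply_apply,
    F.symm_apply_apply] at this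

lemma IsTilting.continuous_iterate_fst (hΓ : Continuous Γ) (n : ℕ) :
    Continuous fun t => (F^[n] (Γ t)).1 :=
  ((F.continuous.iterate n).comp hΓ).fst

lemma IsTilting.iterate_fst_add_one (hF : IsTilting F) (hΓ : ∀ x, Γ (x + 1) = Γ x + (1, 0))
    (n : ℕ) (x : ℝ) : (F^[n] (Γ (x + 1))).1 = (F^[n] (Γ x)).1 + 1 := by
  rw [hΓ, hF.iterate_add]; rfl

/-- If `w` and `F^k w` lie below the invariant curve, so does every `F^i w`, `i ≤ k`: as `t`
varies, the sequence of signs of the horizontal position of `F^i (Γ t)` relative to `F^i w` never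
acquires a change from `+` to `-`. -/
theorem IsTilting.iterate_mem_belowSet (hF : IsTilting F) (hΓ : IsEssentialCircleParam Γ)
    (hT : ∀ p, F p ∈ Set.range Γ ↔ p ∈ Set.range Γ) {w : ℝ × ℝ} {k : ℕ}
    (h0 : w ∈ belowSet (Set.range Γ)) (hk : F^[k] w ∈ belowSet (Set.range Γ)) {i : ℕ}
    (hi : i ≤ k) : F^[i] w ∈ belowSet (Set.range Γ) := by
  obtain ⟨hc, -, hadd⟩ := hΓ
  have hcont := fun n => IsTilting.continuous_iterate_fst (F := F) hc n
  have hmem : ∀ n t, F^[n] (Γ t) ∈ Set.range Γ := fun n t =>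
    (iterate_mem_iff hT n _).2 ⟨t, rfl⟩
  have hwT : w ∉ Set.range Γ := fun h => lt_irrefl _ (h0 w h rfl)
  have hne : ∀ n t, (F^[n] (Γ t)).1 = (F^[n] w).1 → (F^[n] (Γ t)).2 ≠ (F^[n] w).2 := by
    intro n t h1 h2
    have : F^[n] (Γ t) = F^[n] w := Prod.ext h1 h2
    exact hwT (by rw [← (F.injective.iterate n) this]; exact ⟨t, rfl⟩)
  set G : Set ℝ := ⋂ i ∈ Set.Iio k,
    {t | (F^[i] w).1 ≤ (F^[i] (Γ t)).1 → (F^[i + 1] w).1 < (F^[i + 1] (Γ t)).1} with hG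
  have hGmem : ∀ t, t ∈ G ↔ ∀ i < k, (F^[i] w).1 ≤ (F^[i] (Γ t)).1 →
      (F^[i + 1] w).1 < (F^[i + 1] (Γ t)).1 := by
    intro t; simp [hG]
  have hopen : IsOpen G := by
    refine (Set.finite_Iio k).isOpen_biInter fun i _ => ?_
    have : {t | (F^[i] w).1 ≤ (F^[i] (Γ t)).1 → (F^[i + 1] w).1 < (F^[i + 1] (Γ t)).1} =
        {t | (F^[i] (Γ t)).1 < (F^[i] w).1} ∪ {t | (F^[i + 1] w).1 < (F^[i + 1] (Γ t)).1} := by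
      ext t
      simp only [Set.mem_ofPred_eq, Set.mem_union]
      rw [imp_iff_not_or, not_le]
    rw [this]
    exact (isOpen_lt (hcont i) continuous_const).union (isOpen_lt continuous_const (hcont _))
  have hclosed : IsClosed G := by
    refine isClosed_of_closure_subset fun t ht => ?_
    rw [mem_closure_iff_frequently] at ht
    have step : ∀ i < k, (∃ᶠ s in 𝓝 t, s ∈ G ∧ (F^[i] w).1 < (F^[i] (Γ s)).1) →
        (∃ᶠ s in 𝓝 t, s ∈ G ∧ (F^[i + 1] w).1 < (F^[i + 1] (Γ s)).1) := fun i hi h =>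
      h.mono fun s hs => ⟨hs.1, (hGmem s).1 hs.1 i hi hs.2.le⟩
    have start : ∀ i, (F^[i] w).1 < (F^[i] (Γ t)).1 →
        (∃ᶠ s in 𝓝 t, s ∈ G ∧ (F^[i] w).1 < (F^[i] (Γ s)).1) := fun i h =>
      ht.and_eventually ((hcont i).continuousAt.eventually_const_lt h)
    have finish : ∀ i, (∃ᶠ s in 𝓝 t, s ∈ G ∧ (F^[i] w).1 < (F^[i] (Γ s)).1) →
        (F^[i] w).1 ≤ (F^[i] (Γ t)).1 := by
      intro i h
      by_contra! hlt
      obtain ⟨s, hs1, hs2⟩ :=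
        (h.and_eventually ((hcont i).continuousAt.eventually_lt_const hlt)).exists
      exact lt_asymm hs1.2 hs2
    rw [hGmem]
    intro i hi hle
    rcases hle.lt_or_eq with hlt | heq
    · refine (finish _ (step i hi (start i hlt))).lt_of_ne fun heq => ?_
      rcases (hne _ _ heq.symm).lt_or_gt with hb | ha
      · rcases (Nat.succ_le_of_lt hi).lt_or_eq with hi' | rfl
        · have h1 := finish _ (step _ hi' (step i hi (start i hlt)))
          exact absurd (hF.lt_succ heq.symm hb) (not_lt.2 h1)
        · exact lt_asymm (hk _ (hmem _ t) heq.symm) hb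
      · exact lt_asymm (hF.lt_pred heq ha) hlt
    · rcases (hne _ _ heq.symm).lt_or_gt with hb | ha
      · rcases i with _ | j
        · exact absurd (h0 _ ⟨t, rfl⟩ heq.symm) (not_lt.2 hb.le)
        · have hj := hF.lt_pred heq.symm hb
          have h1 := finish _ (step _ hi (step j (by omega) (start j hj)))
          exact absurd (hF.lt_succ heq.symm hb) (not_lt.2 h1)
      · exact hF.lt_succ heq ha
  have hnonempty : G.Nonempty := by
    have hev : ∀ᶠ t in atBot, ∀ i ∈ Set.Iio k, (F^[i] (Γ t)).1 < (F^[i] w).1 :=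
      (eventually_all_finite (Set.finite_Iio k)).2 fun i _ =>
        (tendsto_atBot_of_add_one (hcont i) (hF.iterate_fst_add_one hadd i)).eventually_lt_atBot _
    obtain ⟨t, ht⟩ := hev.exists
    exact ⟨t, (hGmem t).2 fun i hi h => absurd (ht i hi) (not_lt.2 h)⟩
  have huniv := IsClopen.eq_univ ⟨hclosed, hopen⟩ hnonempty
  rcases hi.lt_or_eq with hi | rfl
  · intro q hq hq1
    obtain ⟨p, rfl⟩ := (F.surjective.iterate i) q
    obtain ⟨t, rfl⟩ := (iterate_mem_iff hT i p).1 hq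
    have ht : t ∈ G := huniv ▸ Set.mem_univ t
    have h1 := (hGmem t).1 ht i hi hq1.symm.le
    rcases (hne _ _ hq1).lt_or_gt with hb | ha
    · exact absurd (hF.lt_succ hq1 hb) (lt_asymm h1)
    · exact ha
  · exact hk

/-- An orbit cannot go from below the invariant curve to above it. -/
theorem IsTilting.iterate_notMem_aboveSet (hF : IsTilting F) (hΓ : IsEssentialCircleParam Γ)
    (hT : ∀ p, F p ∈ Set.range Γ ↔ p ∈ Set.range Γ) {w : ℝ × ℝ} (k : ℕ)
    (h0 : w ∈ belowSet (Set.range Γ)) : F^[k] w ∉ aboveSet (Set.range Γ) := by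
  intro hk
  obtain ⟨hc, -, hadd⟩ := hΓ
  have hcont := fun n => IsTilting.continuous_iterate_fst (F := F) hc n
  have hmem : ∀ n t, F^[n] (Γ t) ∈ Set.range Γ := fun n t =>
    (iterate_mem_iff hT n _).2 ⟨t, rfl⟩
  have hwT : w ∉ Set.range Γ := fun h => lt_irrefl _ (h0 w h rfl)
  have hne : ∀ n t, (F^[n] (Γ t)).1 = (F^[n] w).1 → (F^[n] (Γ t)).2 ≠ (F^[n] w).2 := by
    intro n t h1 h2
    have : F^[n] (Γ t) = F^[n] w := Prod.ext h1 h2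
    exact hwT (by rw [← (F.injective.iterate n) this]; exact ⟨t, rfl⟩)
  set G : Set ℝ := ⋂ i ∈ Set.Iic k, {t | (F^[i] (Γ t)).1 < (F^[i] w).1} with hG
  have hGmem : ∀ t, t ∈ G ↔ ∀ i ≤ k, (F^[i] (Γ t)).1 < (F^[i] w).1 := by
    intro t; simp [hG]
  have hopen : IsOpen G :=
    (Set.finite_Iic k).isOpen_biInter fun i _ => isOpen_lt (hcont i) continuous_const
  have hclosed : IsClosed G := by
    refine isClosed_of_closure_subset fun t ht => ?_
    have hle : ∀ i ≤ k, (F^[i] (Γ t)).1 ≤ (F^[i] w).1 := fun i hi =>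
      closure_minimal (fun s hs => ((hGmem s).1 hs i hi).le)
        (isClosed_le (hcont i) continuous_const) ht
    rw [hGmem]
    intro i hi
    refine (hle i hi).lt_of_ne fun heq => ?_
    rcases (hne _ _ heq).lt_or_gt with hb | ha
    · rcases i with _ | j
      · exact lt_asymm (h0 _ ⟨t, rfl⟩ heq) hb
      · exact absurd (hF.lt_pred heq hb) (not_lt.2 (hle j (by omega)))
    · rcases hi.lt_or_eq with hi' | rfl
      · exact absurd (hF.lt_succ heq.symm ha) (not_lt.2 (hle _ hi'))
      · exact lt_asymm (hk _ (hmem _ t) heq) ha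
  have hnonempty : G.Nonempty := by
    have hev : ∀ᶠ t in atBot, ∀ i ∈ Set.Iic k, (F^[i] (Γ t)).1 < (F^[i] w).1 :=
      (eventually_all_finite (Set.finite_Iic k)).2 fun i _ =>
        (tendsto_atBot_of_add_one (hcont i) (hF.iterate_fst_add_one hadd i)).eventually_lt_atBot _
    obtain ⟨t, ht⟩ := hev.exists
    exact ⟨t, (hGmem t).2 ht⟩
  have huniv := IsClopen.eq_univ ⟨hclosed, hopen⟩ hnonempty
  obtain ⟨t, ht⟩ := ((tendsto_atTop_of_add_one (hcont 0)
    (hF.iterate_fst_add_one hadd 0)).eventually_gt_atTop (F^[0] w).1).exists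
  exact lt_asymm ht ((hGmem t).1 (huniv ▸ Set.mem_univ t) 0 (Nat.zero_le k))

end Crossing

section Measure

open MeasureTheory

/-- Invariance of a subset of the plane under the deck transformations. -/
def IsPeriodicSet (A : Set (ℝ × ℝ)) : Prop := ∀ p, p + (1, 0) ∈ A ↔ p ∈ A

lemma IsPeriodicSet.add_zsmul_mem_iff {A : Set (ℝ × ℝ)} (hA : IsPeriodicSet A) (n : ℤ) (p : ℝ × ℝ) :
    p + n • ((1 : ℝ), (0 : ℝ)) ∈ A ↔ p ∈ A := by
  induction n using Int.induction_on with
  | zero => simp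
  | succ n ih => rw [add_zsmul, one_zsmul, ← add_assoc, hA, ih]
  | pred n ih => rw [← ih, ← hA, add_assoc, sub_zsmul, one_zsmul, neg_add_cancel_right]

lemma IsPeriodicSet.vadd_preimage {A : Set (ℝ × ℝ)} (hA : IsPeriodicSet A)
    (g : AddSubgroup.zmultiples ((1 : ℝ), (0 : ℝ))) : (fun x => g +ᵥ x) ⁻¹' A = A := by
  obtain ⟨g, n, rfl⟩ := g
  ext p
  have := hA.add_zsmul_mem_iff n p
  rw [add_comm] at this
  exact this

lemma IsPeriodicSet.diff {A B : Set (ℝ × ℝ)} (hA : IsPeriodicSet A) (hB : IsPeriodicSet B) :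
    IsPeriodicSet (A \ B) := fun p => and_congr (hA p) (not_congr (hB p))

/-- The fundamental domain `[0, 1) × ℝ` of the annulus. -/
def strip : Set (ℝ × ℝ) := Set.Ico 0 1 ×ˢ Set.univ

lemma measurableSet_strip : MeasurableSet strip := measurableSet_Ico.prod MeasurableSet.univ

lemma isAddFundamentalDomain_image (E : (ℝ × ℝ) ≃ₜ (ℝ × ℝ))
    (hE : ∀ p, E (p + (1, 0)) = E p + (1, 0)) :
    IsAddFundamentalDomain (AddSubgroup.zmultiples ((1 : ℝ), (0 : ℝ))) (E '' strip) := by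
  have hE' : ∀ (n : ℤ) (p : ℝ × ℝ), E.symm (n • ((1 : ℝ), (0 : ℝ)) + p) =
      n • ((1 : ℝ), (0 : ℝ)) + E.symm p := by
    have h1 : ∀ p, E.symm (p + (1, 0)) = E.symm p + (1, 0) := fun p => by
      rw [Homeomorph.symm_apply_eq, hE, E.apply_symm_apply]
    intro n p
    induction n using Int.induction_on generalizing p with
    | zero => simp
    | succ n ih => rw [add_zsmul, one_zsmul, add_assoc, ih, add_comm _ p, h1]; abel
    | pred n ih =>
      have h2 := h1 (p - (1, 0))
      rw [sub_add_cancel] at h2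
      rw [sub_zsmul, one_zsmul, add_assoc, ih, neg_add_eq_sub, h2]; abel
  refine IsAddFundamentalDomain.mk'
    (E.toMeasurableEquiv.measurableSet_image.2 measurableSet_strip).nullMeasurableSet fun p => ?_
  have key : ∀ n : ℤ, n • ((1 : ℝ), (0 : ℝ)) + p ∈ E '' strip ↔
      (E.symm p).1 + n • (1 : ℝ) ∈ Set.Ico (0 : ℝ) (0 + 1) := by
    intro n
    rw [E.image_eq_preimage_symm, Set.mem_preimage, hE']
    simp [strip, add_comm]
  obtain ⟨n, hn, huniq⟩ := existsUnique_add_zsmul_mem_Ico one_pos (E.symm p).1 0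
  refine ⟨⟨n • (1, 0), n, rfl⟩, (key n).2 hn, ?_⟩
  rintro ⟨_, m, rfl⟩ hm
  have := huniq m ((key m).1 hm)
  subst this
  rfl

lemma isAddFundamentalDomain_strip :
    IsAddFundamentalDomain (AddSubgroup.zmultiples ((1 : ℝ), (0 : ℝ))) strip := by
  simpa using isAddFundamentalDomain_image (Homeomorph.refl _) fun _ => rfl

/-- The area measure of the annulus, as a measure on its fundamental domain. -/
noncomputable def stripVolume : Measure (ℝ × ℝ) := volume.restrict strip

lemma IsPeriodicSet.volume_eq_zero {A : Set (ℝ × ℝ)} (hA : IsPeriodicSet A)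
    (hm : MeasurableSet A) (h0 : stripVolume A = 0) : volume A = 0 := by
  rw [stripVolume, Measure.restrict_apply hm] at h0
  exact isAddFundamentalDomain_strip.measure_zero_of_invariant _ (fun g => by
    rw [← hA.vadd_preimage (-g), ← Set.preimage_vadd_neg]
    simp [hA.vadd_preimage]) h0

namespace TwistMap

variable (f : TwistMap)

lemma volume_image_homeo {A : Set (ℝ × ℝ)} (hA : MeasurableSet A) :
    volume (f.homeo '' A) = volume A := by
  change volume (f.F '' A) = volume A
  rw [← lintegral_abs_det_fderiv_eq_addHaar_image volume hA
    (fun p _ => (f.hasFDerivAt_F p).hasFDerivWithinAt) f.homeo.injective.injOn]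
  simp [det_fderiv]

lemma homeo_add (p : ℝ × ℝ) : f.homeo (p + (1, 0)) = f.homeo p + (1, 0) := f.F_add p

lemma isPeriodicSet_preimage {A : Set (ℝ × ℝ)} (hA : IsPeriodicSet A) :
    IsPeriodicSet (f.homeo ⁻¹' A) := fun p => by
  rw [Set.mem_preimage, f.homeo_add, hA, Set.mem_preimage]

lemma stripVolume_preimage {A : Set (ℝ × ℝ)} (hA : IsPeriodicSet A) (hm : MeasurableSet A) :
    stripVolume (f.homeo ⁻¹' A) = stripVolume A := by
  have hm' : MeasurableSet (f.homeo ⁻¹' A) := f.homeo.continuous.measurable hm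
  rw [stripVolume, Measure.restrict_apply hm, Measure.restrict_apply hm',
    ← f.volume_image_homeo (hm'.inter measurableSet_strip), Set.image_inter f.homeo.injective,
    f.homeo.image_preimage]
  exact (isAddFundamentalDomain_image f.homeo f.homeo_add).measure_set_eq
    isAddFundamentalDomain_strip hm fun g => hA.vadd_preimage g

end TwistMap

lemma stripVolume_region {g : ℝ → ℝ} (hg : Continuous g) {β : ℝ} (hβ : ∀ x, β ≤ g x) :
    stripVolume {p : ℝ × ℝ | β < p.2 ∧ p.2 ≤ g p.1} =
      ENNReal.ofReal (∫ x in (0 : ℝ)..1, (g x - β)) := by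
  have hm : MeasurableSet {p : ℝ × ℝ | β < p.2 ∧ p.2 ≤ g p.1} :=
    (measurableSet_lt measurable_const measurable_snd).inter
      (measurableSet_le measurable_snd (hg.measurable.comp measurable_fst))
  rw [stripVolume, strip, Measure.volume_eq_prod, ← Measure.prod_restrict, Measure.restrict_univ,
    Measure.prod_apply hm]
  have hsec : ∀ x : ℝ, volume (Prod.mk x ⁻¹' {p : ℝ × ℝ | β < p.2 ∧ p.2 ≤ g p.1}) =
      ENNReal.ofReal (g x - β) := fun x => by
    rw [← Real.volume_Ioc]; rfl
  simp_rw [hsec]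
  rw [intervalIntegral.integral_of_le zero_le_one, ← integral_Ico_eq_integral_Ioc,
    ofReal_integral_eq_lintegral_ofReal]
  · exact ((hg.sub continuous_const).integrableOn_Icc (a := 0) (b := 1)).mono_set
      Set.Ico_subset_Icc_self
  · exact Filter.Eventually.of_forall fun x => sub_nonneg.2 (hβ x)

namespace TwistMap

variable (f : TwistMap)

lemma integral_dh_eq_zero (b : ℝ) : ∫ θ in (0 : ℝ)..1, f.dh (1, 0) (θ, b) = 0 := by
  have hc := (f.contDiff_dh (1, 0)).continuous
  rw [intervalIntegral.integral_eq_sub_of_hasDerivAt (fun θ _ => f.hasDerivAt_h_fst θ b)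
    (Continuous.intervalIntegrable (by fun_prop) _ _)]
  have := f.periodic_h 0 b
  rw [zero_add] at this
  rw [this, sub_self]

lemma dh_add_one (θ b : ℝ) : f.dh (1, 0) (θ + 1, b) = f.dh (1, 0) (θ, b) := by
  have h1 := (f.hasDerivAt_h_fst (θ + 1) b).comp_add_const θ 1
  simp only [f.periodic_h] at h1
  exact h1.unique (f.hasDerivAt_h_fst θ b)

lemma exists_le_dh (b : ℝ) : ∃ C, ∀ θ, C ≤ f.dh (1, 0) (θ, b) := by
  have hc := (f.contDiff_dh (1, 0)).continuous
  obtain ⟨C, hC⟩ := exists_abs_sub_le_of_add_one (g := fun θ => f.dh (1, 0) (θ, b) + θ)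
    (by fun_prop) (fun θ => by rw [dh_add_one]; ring)
  refine ⟨-C, fun θ => ?_⟩
  have := (abs_le.1 (hC θ)).1
  linarith

/-- Zero flux: a region of the annulus below an essential set and its preimage have the same
relative area. -/
lemma stripVolume_diff_preimage {S : Set (ℝ × ℝ)} (hS : IsPeriodicSet S) (hm : MeasurableSet S)
    {b c : ℝ} (hb : ∀ p : ℝ × ℝ, p.2 ≤ b → p ∈ S) (hc : ∀ p ∈ S, p.2 ≤ c) :
    stripVolume (S \ f.homeo ⁻¹' S) = stripVolume (f.homeo ⁻¹' S \ S) := by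
  obtain ⟨C, hC⟩ := f.exists_le_dh b
  set β := min b (b + C) with hβ
  have hβb : β ≤ b := min_le_left _ _
  have hβC : ∀ θ, β ≤ b + f.dh (1, 0) (θ, b) := fun θ =>
    (min_le_right _ _).trans (by linarith [hC θ])
  set H : Set (ℝ × ℝ) := {p | p.2 ≤ b} with hH
  set L : Set (ℝ × ℝ) := {p | p.2 ≤ β} with hL
  have hHm : MeasurableSet H := measurableSet_le measurable_snd measurable_const
  have hLm : MeasurableSet L := measurableSet_le measurable_snd measurable_const
  have hHp : IsPeriodicSet H := fun p => by simp [hH]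
  have hFm : ∀ {A : Set (ℝ × ℝ)}, MeasurableSet A → MeasurableSet (f.homeo ⁻¹' A) :=
    fun h => f.homeo.continuous.measurable h
  have hLH : L ⊆ H := fun p hp => le_trans hp hβb
  have hLG : L ⊆ f.homeo ⁻¹' H := fun p hp =>
    (f.F_snd_le_iff p b).2 (le_trans hp (hβC p.1))
  have hHS : H ⊆ S := fun p hp => hb p hp
  have hGS : f.homeo ⁻¹' H ⊆ f.homeo ⁻¹' S := Set.preimage_mono hHS
  have hflux : stripVolume (f.homeo ⁻¹' H \ L) = stripVolume (H \ L) := by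
    have hc := (f.contDiff_dh (1, 0)).continuous
    have e1 : f.homeo ⁻¹' H \ L = {p | β < p.2 ∧ p.2 ≤ b + f.dh (1, 0) (p.1, b)} := by
      ext p
      have := f.F_snd_le_iff p b
      simp only [hH, hL, Set.mem_sdiff, Set.mem_preimage, Set.mem_ofPred_eq, homeo_apply, this,
        not_le]
      tauto
    have e2 : H \ L = {p | β < p.2 ∧ p.2 ≤ b} := by
      ext p
      simp only [hH, hL, Set.mem_sdiff, Set.mem_ofPred_eq, not_le]
      tauto
    rw [e1, e2, stripVolume_region (g := fun x => b + f.dh (1, 0) (x, b)) (by fun_prop) hβC,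
      stripVolume_region (g := fun _ => b) continuous_const fun _ => hβb]
    congr 1
    have : ∀ x, b + f.dh (1, 0) (x, b) - β = f.dh (1, 0) (x, b) + (b - β) := fun x => by ring
    simp_rw [this]
    rw [intervalIntegral.integral_add (Continuous.intervalIntegrable (by fun_prop) _ _)
      (Continuous.intervalIntegrable (by fun_prop) _ _), f.integral_dh_eq_zero, zero_add]
  have split : ∀ {A B : Set (ℝ × ℝ)}, MeasurableSet B → L ⊆ B → B ⊆ A →
      stripVolume (A \ L) = stripVolume (A \ B) + stripVolume (B \ L) := by
    intro A B hB h1 h2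
    rw [← measure_union (Set.disjoint_left.2 fun p hp hp' => hp.2 hp'.1) (hB.diff hLm)]
    congr 1
    ext p
    have := @h1 p
    have := @h2 p
    simp only [Set.mem_sdiff, Set.mem_union]
    tauto
  have heq : stripVolume (S \ L) = stripVolume (f.homeo ⁻¹' S \ L) := by
    rw [split hHm hLH hHS, split (hFm hHm) hLG hGS, hflux, ← Set.preimage_sdiff,
      f.stripVolume_preimage (hS.diff hHp) (hm.diff hHm)]
  have hfin : stripVolume (S \ L) ≠ ⊤ := by
    refine ne_top_of_le_ne_top (b := stripVolume {p : ℝ × ℝ | β < p.2 ∧ p.2 ≤ max c β}) ?_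
      (measure_mono fun p hp => ⟨not_le.1 hp.2, (hc p hp.1).trans (le_max_left _ _)⟩)
    rw [stripVolume_region (g := fun _ => max c β) continuous_const fun _ => le_max_right _ _]
    exact ENNReal.ofReal_ne_top
  have i1 := measure_sdiff_add_inter (μ := stripVolume) (S \ L) ((hFm hm).diff hLm)
  have i2 := measure_sdiff_add_inter (μ := stripVolume) (f.homeo ⁻¹' S \ L) (hm.diff hLm)
  rw [Set.inter_comm, ← heq, ← i1] at i2
  have hne : stripVolume ((S \ L) ∩ (f.homeo ⁻¹' S \ L)) ≠ ⊤ :=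
    ne_top_of_le_ne_top hfin (measure_mono Set.inter_subset_left)
  have i3 := (ENNReal.add_left_inj hne).1 i2
  have j1 : (f.homeo ⁻¹' S \ L) \ (S \ L) = f.homeo ⁻¹' S \ S := by
    ext p
    have := @hLH p
    have := @hHS p
    simp only [Set.mem_sdiff]
    tauto
  have j2 : (S \ L) \ (f.homeo ⁻¹' S \ L) = S \ f.homeo ⁻¹' S := by
    ext p
    have := @hLG p
    have := @hGS p
    simp only [Set.mem_sdiff]
    tauto
  rw [j1, j2] at i3
  exact i3.symm

end TwistMap

end Measure

section Circle

lemma IsOpen.subset_closure_of_volume_diff {U V : Set (ℝ × ℝ)} (hU : IsOpen U)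
    (h0 : MeasureTheory.volume (U \ V) = 0) : U ⊆ closure V := by
  have h1 : U \ closure V = ∅ := (hU.sdiff isClosed_closure).measure_eq_zero_iff
    (MeasureTheory.volume) |>.1
    (MeasureTheory.measure_mono_null (Set.sdiff_subset_sdiff_right subset_closure) h0)
  exact Set.sdiff_eq_empty.1 h1

variable {Γ : ℝ → ℝ × ℝ}

namespace IsEssentialCircleParam

lemma fst_add_one (hΓ : IsEssentialCircleParam Γ) (t : ℝ) : (Γ (t + 1)).1 = (Γ t).1 + 1 := by
  rw [hΓ.2.2]; rfl

lemma snd_add_one (hΓ : IsEssentialCircleParam Γ) (t : ℝ) : (Γ (t + 1)).2 = (Γ t).2 := by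
  rw [hΓ.2.2]; simp

lemma surjective_fst (hΓ : IsEssentialCircleParam Γ) : Function.Surjective fun t => (Γ t).1 :=
  surjective_of_add_one hΓ.1.fst hΓ.fst_add_one

lemma exists_abs_snd_le (hΓ : IsEssentialCircleParam Γ) : ∃ M, ∀ t, |(Γ t).2| ≤ M := by
  have hc := hΓ.1
  obtain ⟨C, hC⟩ := exists_abs_sub_le_of_add_one (g := fun t => (Γ t).2 + t) (by fun_prop)
    (fun t => by rw [hΓ.snd_add_one]; ring)
  exact ⟨C, fun t => by simpa using hC t⟩

lemma isClosedEmbedding (hΓ : IsEssentialCircleParam Γ) : Topology.IsClosedEmbedding Γ := by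
  refine .of_continuous_injective_isClosedMap hΓ.1 hΓ.2.1 ?_
  refine (isProperMap_iff_tendsto_cocompact.2 ⟨hΓ.1, ?_⟩).isClosedMap
  refine (Filter.tendsto_comap_iff.2 ?_).mono_right (Filter.comap_cocompact_le continuous_fst)
  simp_rw [cocompact_eq_atBot_atTop]
  exact (tendsto_atBot_of_add_one hΓ.1.fst hΓ.fst_add_one).sup_sup
    (tendsto_atTop_of_add_one hΓ.1.fst hΓ.fst_add_one)

lemma isOpen_belowSet (hΓ : IsEssentialCircleParam Γ) : IsOpen (belowSet (Set.range Γ)) := by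
  have hc := hΓ.1
  obtain ⟨C, hC⟩ := exists_abs_sub_le_of_add_one hΓ.1.fst hΓ.fst_add_one
  rw [← isClosed_compl_iff]
  have hcl : IsClosed {z : (ℝ × ℝ) × Set.Icc (-C) C |
      (Γ (z.1.1 - z.2)).1 = z.1.1 ∧ (Γ (z.1.1 - z.2)).2 ≤ z.1.2} := by
    rw [Set.ofPred_and]
    refine (isClosed_eq ?_ ?_).inter (isClosed_le ?_ ?_) <;> fun_prop
  convert isClosedMap_fst_of_compactSpace _ hcl using 1
  ext p
  simp only [belowSet, Set.mem_compl_iff, Set.mem_ofPred_eq, Set.mem_image, not_forall, not_lt]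
  constructor
  · rintro ⟨_, ⟨t, rfl⟩, h1, h2⟩
    refine ⟨(p, ⟨p.1 - t, abs_le.1 (h1 ▸ hC t)⟩), ?_, rfl⟩
    simpa using ⟨h1, h2⟩
  · rintro ⟨z, ⟨h1, h2⟩, rfl⟩
    exact ⟨_, ⟨_, rfl⟩, h1, h2⟩

lemma isPeriodicSet_range (hΓ : IsEssentialCircleParam Γ) : IsPeriodicSet (Set.range Γ) := by
  intro p
  constructor
  · rintro ⟨t, ht⟩
    refine ⟨t - 1, ?_⟩
    have := hΓ.2.2 (t - 1)
    rw [sub_add_cancel, ht] at this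
    exact (add_right_cancel this).symm
  · rintro ⟨t, rfl⟩
    exact ⟨t + 1, hΓ.2.2 t⟩

lemma isPeriodicSet_belowSet (hΓ : IsEssentialCircleParam Γ) :
    IsPeriodicSet (belowSet (Set.range Γ)) := by
  intro p
  constructor
  · intro hp q hq hqp
    simpa using hp (q + (1, 0)) ((hΓ.isPeriodicSet_range q).2 hq) (by simp [hqp])
  · intro hp q hq hqp
    have h1 := (hΓ.isPeriodicSet_range (q - (1, 0))).1 (by rwa [sub_add_cancel])
    simpa using hp _ h1 (by simp [hqp])

end IsEssentialCircleParam

namespace TwistMap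

variable (f : TwistMap)

lemma isTilting : IsTilting f.homeo where
  map_add := f.homeo_add
  fst_lt _ _ h1 h2 := f.F_fst_lt h1 h2
  symm_fst_lt _ _ h1 h2 := f.homeo_symm_fst_lt h1 h2

lemma volume_diff_preimage_eq_zero {S : Set (ℝ × ℝ)} (hS : IsPeriodicSet S)
    (hm : MeasurableSet S) {b c : ℝ} (hb : ∀ p : ℝ × ℝ, p.2 ≤ b → p ∈ S) (hc : ∀ p ∈ S, p.2 ≤ c)
    (h0 : MeasureTheory.volume (f.homeo ⁻¹' S \ S) = 0) :
    MeasureTheory.volume (S \ f.homeo ⁻¹' S) = 0 := by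
  have hm' : MeasurableSet (f.homeo ⁻¹' S) := f.homeo.continuous.measurable hm
  refine (hS.diff (f.isPeriodicSet_preimage hS)).volume_eq_zero (hm.diff hm') ?_
  rw [f.stripVolume_diff_preimage hS hm hb hc]
  exact MeasureTheory.Measure.absolutelyContinuous_of_le MeasureTheory.Measure.restrict_le_self h0

lemma volume_preimage_diff_eq_zero {S : Set (ℝ × ℝ)} (hS : IsPeriodicSet S)
    (hm : MeasurableSet S) {b c : ℝ} (hb : ∀ p : ℝ × ℝ, p.2 ≤ b → p ∈ S) (hc : ∀ p ∈ S, p.2 ≤ c)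
    (h0 : S ⊆ f.homeo ⁻¹' S) : MeasureTheory.volume (f.homeo ⁻¹' S \ S) = 0 := by
  have hm' : MeasurableSet (f.homeo ⁻¹' S) := f.homeo.continuous.measurable hm
  refine ((f.isPeriodicSet_preimage hS).diff hS).volume_eq_zero (hm'.diff hm) ?_
  rw [← f.stripVolume_diff_preimage hS hm hb hc, Set.sdiff_eq_empty.2 h0]
  exact MeasureTheory.measure_empty

lemma volume_preimage_belowSet_diff (hΓ : IsEssentialCircleParam Γ)
    (hT : ∀ p, f.homeo p ∈ Set.range Γ ↔ p ∈ Set.range Γ) :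
    MeasureTheory.volume (f.homeo ⁻¹' belowSet (Set.range Γ) \ belowSet (Set.range Γ)) = 0 := by
  obtain ⟨M, hM⟩ := hΓ.exists_abs_snd_le
  set W := belowSet (Set.range Γ) with hW
  set Ω : Set (ℝ × ℝ) := ⋃ k : ℕ, f.homeo.symm^[k] ⁻¹' W with hΩ
  have hinv : ∀ k : ℕ, Function.LeftInverse f.homeo.symm^[k] f.homeo^[k] := fun k =>
    Function.LeftInverse.iterate f.homeo.symm_apply_apply k
  have hinv' : ∀ k : ℕ, Function.LeftInverse f.homeo^[k] f.homeo.symm^[k] := fun k =>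
    Function.LeftInverse.iterate f.homeo.apply_symm_apply k
  have hadd : ∀ (k : ℕ) p, f.homeo.symm^[k] (p + (1, 0)) = f.homeo.symm^[k] p + (1, 0) := by
    intro k
    induction k with
    | zero => exact fun p => rfl
    | succ k ih =>
      intro p
      rw [Function.iterate_succ_apply, Function.iterate_succ_apply, f.homeo_symm_add, ih]
  have hΩm : MeasurableSet Ω := (isOpen_iUnion fun k =>
    hΓ.isOpen_belowSet.preimage (f.homeo.symm.continuous.iterate k)).measurableSet
  have hΩp : IsPeriodicSet Ω := fun p => by
    simp only [hΩ, Set.mem_iUnion, Set.mem_preimage, hadd, hΓ.isPeriodicSet_belowSet _, hW]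
  have hb : ∀ p : ℝ × ℝ, p.2 ≤ -M - 1 → p ∈ Ω := fun p hp => by
    refine Set.mem_iUnion.2 ⟨0, ?_⟩
    rintro _ ⟨t, rfl⟩ -
    have := (abs_le.1 (hM t)).1
    simp only [Function.iterate_zero, id]
    linarith
  have hc : ∀ p ∈ Ω, p.2 ≤ M := fun p hp => by
    obtain ⟨k, hk⟩ := Set.mem_iUnion.1 hp
    by_contra! hlt
    refine f.isTilting.iterate_notMem_aboveSet hΓ hT k hk ?_
    rw [hinv' k p]
    rintro _ ⟨t, rfl⟩ -
    exact (abs_le.1 (hM t)).2.trans_lt hlt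
  have hsub : Ω ⊆ f.homeo ⁻¹' Ω := fun p hp => by
    obtain ⟨k, hk⟩ := Set.mem_iUnion.1 hp
    refine Set.mem_iUnion.2 ⟨k + 1, ?_⟩
    rwa [Set.mem_preimage, Function.iterate_succ_apply, f.homeo.symm_apply_apply]
  refine MeasureTheory.measure_mono_null (fun p hp => ?_)
    (f.volume_preimage_diff_eq_zero hΩp hΩm hb hc hsub)
  refine ⟨Set.mem_iUnion.2 ⟨0, hp.1⟩, fun hpΩ => hp.2 ?_⟩
  obtain ⟨k, hk⟩ := Set.mem_iUnion.1 hpΩ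
  have h1 : f.homeo^[k + 1] (f.homeo.symm^[k] p) ∈ W := by
    rw [Function.iterate_succ_apply', hinv' k p]
    exact hp.1
  simpa only [hinv' k p] using f.isTilting.iterate_mem_belowSet hΓ hT hk h1 k.le_succ

lemma volume_belowSet_diff_preimage (hΓ : IsEssentialCircleParam Γ)
    (hT : ∀ p, f.homeo p ∈ Set.range Γ ↔ p ∈ Set.range Γ) :
    MeasureTheory.volume (belowSet (Set.range Γ) \ f.homeo ⁻¹' belowSet (Set.range Γ)) = 0 := by
  obtain ⟨M, hM⟩ := hΓ.exists_abs_snd_le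
  refine f.volume_diff_preimage_eq_zero hΓ.isPeriodicSet_belowSet
    hΓ.isOpen_belowSet.measurableSet (b := -M - 1) (c := M) ?_ ?_
    (f.volume_preimage_belowSet_diff hΓ hT)
  · rintro p hp _ ⟨t, rfl⟩ -
    have := (abs_le.1 (hM t)).1
    linarith
  · intro p hp
    obtain ⟨t, ht⟩ := hΓ.surjective_fst p.1
    exact (hp _ ⟨t, rfl⟩ ht).le.trans (abs_le.1 (hM t)).2

/-- The closure of the region below an invariant circle is invariant. -/
lemma mem_closure_belowSet_iff (hΓ : IsEssentialCircleParam Γ)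
    (hT : ∀ p, f.homeo p ∈ Set.range Γ ↔ p ∈ Set.range Γ)
    (p : ℝ × ℝ) :
    f.homeo p ∈ closure (belowSet (Set.range Γ)) ↔ p ∈ closure (belowSet (Set.range Γ)) := by
  have h1 := hΓ.isOpen_belowSet.subset_closure_of_volume_diff
    (f.volume_belowSet_diff_preimage hΓ hT)
  have h2 := (hΓ.isOpen_belowSet.preimage f.homeo.continuous).subset_closure_of_volume_diff
    (f.volume_preimage_belowSet_diff hΓ hT)
  rw [← f.homeo.preimage_closure] at h1
  have h3 := closure_minimal h1 (isClosed_closure.preimage f.homeo.continuous)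
  have h4 := closure_minimal h2 isClosed_closure
  rw [← f.homeo.preimage_closure] at h4
  exact ⟨fun h => h4 h, fun h => h3 h⟩

end TwistMap

end Circle

section Lipschitz

/-- If the vertical lines are tilted to the right by a map `E` preserving the region below the graph
of `ψ`, then `ψ` does not drop too fast to the left of any point. -/
lemma exists_sub_mul_le_of_region_invariant {E G D : ℝ × ℝ → ℝ × ℝ} (hG : Continuous G)
    (hEG : ∀ p, E (G p) = p) (hD : Continuous D)
    (hE1 : ∀ a b, HasDerivAt (fun t => (E (a, t)).1) (D (a, b)).1 b)
    (hE2 : ∀ a b, HasDerivAt (fun t => (E (a, t)).2) (D (a, b)).2 b)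
    (hpos : ∀ p, 0 < (D p).1) {ψ : ℝ → ℝ} {B : ℝ} (hB : ∀ x, |ψ x| ≤ B)
    (hper : ∀ x, ψ (x + 1) = ψ x)
    (hinv : ∀ p, (E p).2 ≤ ψ (E p).1 ↔ p.2 ≤ ψ p.1) :
    ∃ K δ : ℝ, 0 < δ ∧ ∀ y x, x ≤ y → y - δ ≤ x → ψ y - K * (y - x) ≤ ψ x := by
  set Q : Set (ℝ × ℝ) := (fun z : (ℝ × ℝ) × ℝ => ((G z.1).1, (G z.1).2 - z.2)) ''
    ((Set.Icc 0 1 ×ˢ Set.Icc (-B) B) ×ˢ Set.Icc 0 1) with hQ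
  have hQc : IsCompact Q :=
    ((isCompact_Icc.prod isCompact_Icc).prod isCompact_Icc).image (by fun_prop)
  obtain ⟨β, hβ, hβQ⟩ := hQc.exists_forall_le' (f := fun p => (D p).1)
    (by fun_prop) (a := 0) fun p _ => hpos p
  obtain ⟨K, hK⟩ := hQc.exists_bound_of_continuousOn (f := fun p => (D p).2) (by fun_prop)
  have key : ∀ y ∈ Set.Icc (0 : ℝ) 1, ∀ x, x ≤ y → y - β ≤ x →
      ψ y - K / β * (y - x) ≤ ψ x := by
    intro y hy x hxy hyx
    obtain ⟨⟨a, b⟩, hab⟩ : ∃ q, G (y, ψ y) = q := ⟨_, rfl⟩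
    have hEab : E (a, b) = (y, ψ y) := by rw [← hab, hEG]
    have hmem : ∀ t ∈ Set.Icc (b - 1) b, (a, t) ∈ Q := fun t ht =>
      ⟨((y, ψ y), b - t), ⟨⟨hy, abs_le.1 (hB y)⟩, by linarith [ht.2], by linarith [ht.1]⟩,
        by simp [hab]⟩
    have hmem' : ∀ t ∈ interior (Set.Icc (b - 1) b), (a, t) ∈ Q := fun t ht =>
      hmem t (interior_subset ht)
    have hc1 : Continuous fun t => (E (a, t)).1 :=
      continuous_iff_continuousAt.2 fun t => (hE1 a t).continuousAt
    have hc2 : Continuous fun t => (E (a, t)).2 :=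
      continuous_iff_continuousAt.2 fun t => (hE2 a t).continuousAt
    have m1 : ∀ t ∈ Set.Icc (b - 1) b, β * (b - t) ≤ y - (E (a, t)).1 := fun t ht => by
      have := (convex_Icc (b - 1) b).mul_sub_le_image_sub_of_le_deriv hc1.continuousOn
        (fun t _ => (hE1 a t).differentiableAt.differentiableWithinAt) (C := β)
        (fun t ht => by rw [(hE1 a t).deriv]; exact hβQ _ (hmem' t ht))
        t ht b (by simp) ht.2
      simpa [hEab] using this
    have m2 : ∀ t ∈ Set.Icc (b - 1) b, ψ y - (E (a, t)).2 ≤ K * (b - t) := fun t ht => by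
      have := (convex_Icc (b - 1) b).image_sub_le_mul_sub_of_deriv_le hc2.continuousOn
        (fun t _ => (hE2 a t).differentiableAt.differentiableWithinAt) (C := K)
        (fun t ht => by
          rw [(hE2 a t).deriv]; exact (le_abs_self _).trans (hK _ (hmem' t ht)))
        t ht b (by simp) ht.2
      simpa [hEab] using this
    have h0 := m1 (b - 1) (by simp)
    obtain ⟨t, ht, htx⟩ : x ∈ (fun t => (E (a, t)).1) '' Set.Icc (b - 1) b :=
      intermediate_value_Icc (by linarith) hc1.continuousOn
        ⟨by linarith, by simpa [hEab] using hxy⟩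
    simp only at htx
    have hKnn : 0 ≤ K := (norm_nonneg _).trans (hK _ (hmem t ht))
    have hbψ : b ≤ ψ a := (hinv (a, b)).1 (by rw [hEab])
    have h1 := (hinv (a, t)).2 (ht.2.trans hbψ)
    rw [htx] at h1
    have h2 := m2 t ht
    have h3 := m1 t ht
    rw [htx] at h3
    have h4 : K * (b - t) ≤ K / β * (y - x) := by
      rw [div_mul_eq_mul_div, le_div_iff₀ hβ]
      calc K * (b - t) * β = K * (β * (b - t)) := by ring
        _ ≤ K * (y - x) := by gcongr
    linarith
  refine ⟨K / β, β, hβ, fun y x hxy hyx => ?_⟩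
  have hp : ∀ z (n : ℤ), ψ (z - n) = ψ z := fun z n => by
    simpa using (show Function.Periodic ψ 1 from hper).sub_zsmul_eq (x := z) n
  have h1 := key (Int.fract y) ⟨Int.fract_nonneg y, (Int.fract_lt_one y).le⟩ (x - ⌊y⌋)
    (by rw [Int.fract]; linarith) (by rw [Int.fract]; linarith)
  rw [Int.fract, hp, hp, sub_sub_sub_cancel_right] at h1
  exact h1

lemma hasDerivAt_vertical {E : ℝ × ℝ → ℝ × ℝ} (hE : ContDiff ℝ 1 E) (a b : ℝ) :
    HasDerivAt (fun t => E (a, t)) (fderiv ℝ E (a, b) (0, 1)) b := by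
  have h1 : HasDerivAt (fun t : ℝ => (a, t)) ((0 : ℝ), (1 : ℝ)) b :=
    (hasDerivAt_const b a).prodMk (hasDerivAt_id b)
  exact (hE.differentiable (by simp) (a, b)).hasFDerivAt.comp_hasDerivAt b h1

lemma lipschitzWith_of_local {ψ : ℝ → ℝ} {B K δ : ℝ} (hB : ∀ x, |ψ x| ≤ B) (hδ : 0 < δ)
    (h : ∀ x y, x ≤ y → y - x ≤ δ → |ψ y - ψ x| ≤ K * (y - x)) :
    ∃ L : NNReal, LipschitzWith L ψ := by
  have hmain : ∀ x y, x ≤ y → |ψ y - ψ x| ≤ max K (2 * B / δ) * (y - x) := fun x y hxy => by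
    rcases le_total (y - x) δ with h1 | h1
    · exact (h x y hxy h1).trans
        (mul_le_mul_of_nonneg_right (le_max_left _ _) (sub_nonneg.2 hxy))
    · have hB0 : 0 ≤ B := (abs_nonneg _).trans (hB 0)
      calc |ψ y - ψ x| ≤ |ψ y| + |ψ x| := abs_sub _ _
        _ ≤ 2 * B / δ * δ := by rw [div_mul_cancel₀ _ hδ.ne']; linarith [hB x, hB y]
        _ ≤ 2 * B / δ * (y - x) := by gcongr
        _ ≤ _ := mul_le_mul_of_nonneg_right (le_max_right _ _) (sub_nonneg.2 hxy)
  refine ⟨(max K (2 * B / δ)).toNNReal, LipschitzWith.of_dist_le_mul fun x y => ?_⟩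
  rw [Real.dist_eq, Real.dist_eq]
  refine le_trans ?_ (mul_le_mul_of_nonneg_right (Real.le_coe_toNNReal _) (abs_nonneg _))
  rcases le_total x y with hxy | hxy
  · rw [abs_sub_comm, abs_sub_comm x, abs_of_nonneg (sub_nonneg.2 hxy)]
    exact hmain x y hxy
  · rw [abs_of_nonneg (sub_nonneg.2 hxy)]
    exact hmain y x hxy

/-- The boundary of an invariant subgraph is Lipschitz. -/
lemma TwistMap.exists_lipschitzWith (f : TwistMap) {ψ : ℝ → ℝ} {B : ℝ} (hB : ∀ x, |ψ x| ≤ B)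
    (hper : ∀ x, ψ (x + 1) = ψ x)
    (hinv : ∀ p, (f.homeo p).2 ≤ ψ (f.homeo p).1 ↔ p.2 ≤ ψ p.1) :
    ∃ L : NNReal, LipschitzWith L ψ := by
  have hd : ∀ {E : ℝ × ℝ → ℝ × ℝ}, ContDiff ℝ 1 E →
      Continuous fun p => fderiv ℝ E p (0, 1) := fun hE =>
    (hE.continuous_fderiv (by simp)).clm_apply continuous_const
  obtain ⟨K₁, δ₁, hδ₁, h₁⟩ := exists_sub_mul_le_of_region_invariant f.homeo.symm.continuous
    f.homeo.apply_symm_apply (hd f.contDiff_homeo)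
    (fun a b => (hasDerivAt_vertical f.contDiff_homeo a b).fst)
    (fun a b => (hasDerivAt_vertical f.contDiff_homeo a b).snd) f.twist_pos hB hper hinv
  have hd' := hd f.contDiff_homeo_symm
  have hs : ∀ a b, HasDerivAt (fun t => (f.homeo.symm (a, t)).1)
      (fderiv ℝ f.homeo.symm (a, b) (0, 1)).1 b :=
    fun a b => (hasDerivAt_vertical f.contDiff_homeo_symm a b).fst
  obtain ⟨K₂, δ₂, hδ₂, h₂⟩ := exists_sub_mul_le_of_region_invariant (ψ := fun x => ψ (-x))
    (E := fun p => (-(f.homeo.symm (-p.1, p.2)).1, (f.homeo.symm (-p.1, p.2)).2))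
    (G := fun p => (-(f.homeo (-p.1, p.2)).1, (f.homeo (-p.1, p.2)).2))
    (D := fun p => (-(fderiv ℝ f.homeo.symm (-p.1, p.2) (0, 1)).1,
      (fderiv ℝ f.homeo.symm (-p.1, p.2) (0, 1)).2))
    (by fun_prop) (fun p => by simp) (by fun_prop)
    (fun a b => (hs (-a) b).neg)
    (fun a b => (hasDerivAt_vertical f.contDiff_homeo_symm (-a) b).snd)
    (fun p => neg_pos.2 (f.fderiv_homeo_symm_neg _)) (fun x => hB (-x))
    (fun x => by rw [← hper (-(x + 1))]; congr 1; ring)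
    (fun p => by
      have := hinv (f.homeo.symm (-p.1, p.2))
      rw [f.homeo.apply_symm_apply] at this
      simpa using this.symm)
  refine lipschitzWith_of_local (K := max K₁ K₂) hB (lt_min hδ₁ hδ₂) fun x y hxy hyx => ?_
  have i1 := h₁ y x hxy (by linarith [min_le_left δ₁ δ₂])
  have i2 := h₂ (-x) (-y) (neg_le_neg hxy) (by linarith [min_le_right δ₁ δ₂])
  have i3 := mul_le_mul_of_nonneg_right (le_max_left K₁ K₂) (sub_nonneg.2 hxy)
  have i4 := mul_le_mul_of_nonneg_right (le_max_right K₁ K₂) (sub_nonneg.2 hxy)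
  simp only [neg_neg, neg_sub_neg] at i2
  rw [abs_le]
  constructor <;> linarith

end Lipschitz

section Graph

variable {Γ : ℝ → ℝ × ℝ}

lemma le_sSup_fiber_iff {C : Set (ℝ × ℝ)} (hC : IsClosed C)
    (hdown : ∀ p ∈ C, ∀ y ≤ p.2, (p.1, y) ∈ C) {b c : ℝ} (hb : ∀ x, (x, b) ∈ C)
    (hc : ∀ p ∈ C, p.2 ≤ c) (p : ℝ × ℝ) :
    p ∈ C ↔ p.2 ≤ sSup {y | (p.1, y) ∈ C} := by
  have hbdd : BddAbove {y | (p.1, y) ∈ C} := ⟨c, fun y hy => hc _ hy⟩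
  constructor
  · exact fun hp => le_csSup hbdd hp
  · intro hp
    have hcl : IsClosed {y | (p.1, y) ∈ C} := hC.preimage (f := fun y => (p.1, y)) (by fun_prop)
    exact hdown _ (hcl.csSup_mem ⟨b, hb p.1⟩ hbdd) _ hp

lemma IsEssentialCircleParam.exists_closure_belowSet_eq (hΓ : IsEssentialCircleParam Γ) :
    ∃ (ψ : ℝ → ℝ) (B : ℝ), (∀ x, |ψ x| ≤ B) ∧ (∀ x, ψ (x + 1) = ψ x) ∧
      ∀ p, p ∈ closure (belowSet (Set.range Γ)) ↔ p.2 ≤ ψ p.1 := by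
  obtain ⟨M, hM⟩ := hΓ.exists_abs_snd_le
  set W := belowSet (Set.range Γ) with hW
  have hWp := hΓ.isPeriodicSet_belowSet
  have hper : ∀ p, p + (1, 0) ∈ closure W ↔ p ∈ closure W := fun p => by
    constructor
    · intro hp
      have h1 := map_mem_closure (f := fun q : ℝ × ℝ => q - (1, 0)) (t := W) (by fun_prop) hp
        fun q hq => (hWp _).1 (by rwa [sub_add_cancel])
      simpa using h1
    · exact fun hp => map_mem_closure (f := fun q : ℝ × ℝ => q + (1, 0)) (by fun_prop) hp
        fun q hq => (hWp q).2 hq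
  have hdown : ∀ p ∈ closure W, ∀ y ≤ p.2, (p.1, y) ∈ closure W := fun p hp y hy => by
    have h1 := map_mem_closure (f := fun q : ℝ × ℝ => (q.1, q.2 - (p.2 - y))) (t := W)
      (by fun_prop) hp fun q hq r hr hrq => by
        have := hq r hr hrq
        simp only
        linarith
    simpa using h1
  have hb : ∀ x, (x, -M - 1) ∈ closure W := fun x => subset_closure <| by
    rintro _ ⟨t, rfl⟩ -
    have := (abs_le.1 (hM t)).1
    simp only
    linarith
  have hc : ∀ p ∈ closure W, p.2 ≤ M := by
    refine fun p hp => closure_minimal (t := {p : ℝ × ℝ | p.2 ≤ M}) (fun q hq => ?_)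
      (isClosed_le (by fun_prop) (by fun_prop)) hp
    obtain ⟨t, ht⟩ := hΓ.surjective_fst q.1
    exact (hq _ ⟨t, rfl⟩ ht).le.trans (abs_le.1 (hM t)).2
  have hψ := le_sSup_fiber_iff isClosed_closure hdown hb hc
  set ψ : ℝ → ℝ := fun x => sSup {y | (x, y) ∈ closure W} with hψd
  refine ⟨ψ, M + 1, fun x => abs_le.2 ⟨?_, ?_⟩, fun x => ?_, hψ⟩
  · have := (hψ (x, -M - 1)).1 (hb x)
    simp only at this
    linarith
  · have := hc _ ((hψ (x, ψ x)).2 le_rfl)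
    simp only at this
    linarith
  · refine eq_of_forall_le_iff fun y => ?_
    have h1 := hψ (x + 1, y)
    have h2 := hψ (x, y)
    have h3 := hper (x, y)
    rw [Prod.mk_add_mk, add_zero] at h3
    exact h1.symm.trans (h3.trans h2)

lemma eventually_fst_eq_of_lt {T : Set (ℝ × ℝ)} {ψ : ℝ → ℝ} (hψ : Continuous ψ)
    (hcl : ∀ p : ℝ × ℝ, p.2 ≤ ψ p.1 → p ∈ closure (belowSet T)) {c : ℝ → ℝ × ℝ}
    (hc : Continuous c) (hcT : ∀ t, c t ∈ T) {s : ℝ} (hs : (c s).2 < ψ (c s).1) :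
    ∀ᶠ t in nhds s, (c t).1 = (c s).1 := by
  obtain ⟨Y, hY1, hY2⟩ := exists_between hs
  have h1 : ∀ᶠ t in nhds s, (c t).2 < Y ∧ Y < ψ (c t).1 :=
    ((hc.snd.tendsto s).eventually_lt_const hY1).and
      (((hψ.comp hc.fst).tendsto s).eventually_const_lt hY2)
  obtain ⟨ε, hε, hball⟩ := Metric.eventually_nhds_iff_ball.1 h1
  refine Metric.eventually_nhds_iff_ball.2 ⟨ε, hε, fun t ht => ?_⟩
  by_contra hne
  have hconn : ((fun t => (c t).1) '' Metric.ball s ε).OrdConnected :=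
    ((Metric.isPreconnected_ball).image _ hc.fst.continuousOn).ordConnected
  have hsub := hconn.uIcc_subset (Set.mem_image_of_mem (fun t => (c t).1) ht)
    (Set.mem_image_of_mem (fun t => (c t).1) (Metric.mem_ball_self hε))
  obtain ⟨z, hz1, hz2⟩ := exists_between (inf_lt_sup.2 hne)
  obtain ⟨r, hr, rfl⟩ := hsub ⟨hz1.le, hz2.le⟩
  have hO : IsOpen {p : ℝ × ℝ | p.1 ∈ Set.Ioo ((c t).1 ⊓ (c s).1) ((c t).1 ⊔ (c s).1) ∧ Y < p.2} :=
    (isOpen_Ioo.preimage continuous_fst).inter (isOpen_lt continuous_const continuous_snd)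
  obtain ⟨w, ⟨hw1, hw2⟩, hw3⟩ := mem_closure_iff.1 (hcl ((c r).1, ψ (c r).1) le_rfl) _ hO
    ⟨⟨hz1, hz2⟩, (hball r hr).2⟩
  obtain ⟨r', hr', hrw⟩ := hsub ⟨hw1.1.le, hw1.2.le⟩
  exact lt_asymm (hw3 _ (hcT r') hrw) ((hball r' hr').1.trans hw2)

namespace TwistMap

variable (f : TwistMap)

lemma homeo_snd_lt {ψ : ℝ → ℝ} (hψ : Continuous ψ)
    (hinv : ∀ p, (f.homeo p).2 ≤ ψ (f.homeo p).1 ↔ p.2 ≤ ψ p.1) {p : ℝ × ℝ}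
    (hp : p.2 < ψ p.1) : (f.homeo p).2 < ψ (f.homeo p).1 := by
  refine ((hinv p).2 hp.le).lt_of_ne fun heq => ?_
  have hcont : Continuous fun y => f.homeo.symm ((f.homeo p).1, y) := by fun_prop
  have hO : IsOpen {y : ℝ | (f.homeo.symm ((f.homeo p).1, y)).2 <
      ψ (f.homeo.symm ((f.homeo p).1, y)).1} :=
    isOpen_lt hcont.snd (hψ.comp hcont.fst)
  have hmem : ∀ᶠ y in nhds (f.homeo p).2, (f.homeo.symm ((f.homeo p).1, y)).2 <
      ψ (f.homeo.symm ((f.homeo p).1, y)).1 := hO.mem_nhds (by simpa using hp)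
  obtain ⟨y, hy1, hy2⟩ := ((hmem.filter_mono nhdsWithin_le_nhds).and
    (self_mem_nhdsWithin (s := Set.Ioi (f.homeo p).2))).exists
  have h1 := (hinv _).2 hy1.le
  rw [f.homeo.apply_symm_apply, ← heq] at h1
  exact not_lt_of_ge h1 hy2

lemma le_snd_of_invariant (hΓ : IsEssentialCircleParam Γ)
    (hT : ∀ p, f.homeo p ∈ Set.range Γ ↔ p ∈ Set.range Γ) {ψ : ℝ → ℝ} (hψ : Continuous ψ)
    (hcl : ∀ p, p ∈ closure (belowSet (Set.range Γ)) ↔ p.2 ≤ ψ p.1) (s : ℝ) :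
    ψ (Γ s).1 ≤ (Γ s).2 := by
  by_contra! hs
  have hinv : ∀ p, (f.homeo p).2 ≤ ψ (f.homeo p).1 ↔ p.2 ≤ ψ p.1 := fun p => by
    rw [← hcl, ← hcl, f.mem_closure_belowSet_iff hΓ hT]
  have h1 := eventually_fst_eq_of_lt hψ (fun p => (hcl p).2) hΓ.1 Set.mem_range_self hs
  have h2 := eventually_fst_eq_of_lt hψ (fun p => (hcl p).2) (f.homeo.continuous.comp hΓ.1)
    (fun t => (hT _).2 ⟨t, rfl⟩) (f.homeo_snd_lt hψ hinv hs)
  obtain ⟨t, ⟨ht1, ht2⟩, hts⟩ := (((h1.and h2).filter_mono nhdsWithin_le_nhds).and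
    (self_mem_nhdsWithin (s := {s}ᶜ))).exists
  refine hts (hΓ.2.1 (Prod.ext ht1 ?_))
  rcases lt_trichotomy (Γ t).2 (Γ s).2 with h | h | h
  · exact absurd ht2 (f.isTilting.fst_lt _ _ ht1 h).ne
  · exact h
  · exact absurd ht2 (f.isTilting.fst_lt _ _ ht1.symm h).ne'

end TwistMap

lemma IsEssentialCircleParam.range_eq_graph (hΓ : IsEssentialCircleParam Γ) {ψ : ℝ → ℝ}
    (hψ : Continuous ψ) (hper : ∀ x, ψ (x + 1) = ψ x) (h : ∀ x, (x, ψ x) ∈ Set.range Γ) :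
    Set.range Γ = {p : ℝ × ℝ | p.2 = ψ p.1} := by
  choose τ hτ using h
  have hτc : Continuous τ := by
    rw [hΓ.isClosedEmbedding.isEmbedding.continuous_iff]
    simp only [Function.comp_def, hτ]
    fun_prop
  have hτs : Function.Surjective τ := surjective_of_add_one hτc fun x => hΓ.2.1 (by
    rw [hΓ.2.2, hτ, hτ, hper, Prod.mk_add_mk, add_zero])
  ext p
  constructor
  · rintro ⟨t, rfl⟩
    obtain ⟨x, rfl⟩ := hτs t
    simp [hτ]
  · intro hp
    exact ⟨τ p.1, by rw [hτ, ← (show p.2 = ψ p.1 from hp)]⟩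

end Graph

/-- An essential topological circle invariant under an exact
area-preserving twist map is the graph of a Lipschitz function `ψ : 𝕋 → ℝ`. -/
theorem invariant_curve_is_lipschitz_graph (f : TwistMap) (T : Set (ℝ × ℝ))
    (hT : IsEssentialCircle T) (hTinv : f.F '' T = T) :
    ∃ ψ : ℝ → ℝ, (∃ K : NNReal, LipschitzWith K ψ) ∧ (∀ x, ψ (x + 1) = ψ x) ∧
      T = {p : ℝ × ℝ | p.2 = ψ p.1} := by
  obtain ⟨Γ, hΓ, rfl⟩ := hT
  have hT : ∀ p, f.homeo p ∈ Set.range Γ ↔ p ∈ Set.range Γ := fun p => by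
    conv_lhs => rw [← hTinv]
    exact f.homeo.injective.mem_set_image
  obtain ⟨ψ, B, hB, hper, hcl⟩ := hΓ.exists_closure_belowSet_eq
  obtain ⟨L, hL⟩ := f.exists_lipschitzWith hB hper fun p => by
    rw [← hcl, ← hcl, f.mem_closure_belowSet_iff hΓ hT]
  refine ⟨ψ, ⟨L, hL⟩, hper, hΓ.range_eq_graph hL.continuous hper fun x => ?_⟩
  by_contra hx
  have hW : (x, ψ x) ∈ belowSet (Set.range Γ) := by
    rintro _ ⟨t, rfl⟩ htx
    simp only at htx ⊢
    have h1 := f.le_snd_of_invariant hΓ hT hL.continuous hcl t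
    rw [htx] at h1
    exact h1.lt_of_ne fun h2 => hx ⟨t, Prod.ext htx h2.symm⟩
  have hO : IsOpen {y : ℝ | (x, y) ∈ belowSet (Set.range Γ)} :=
    hΓ.isOpen_belowSet.preimage (f := fun y => (x, y)) (by fun_prop)
  have hmem : ∀ᶠ y in nhds (ψ x), (x, y) ∈ belowSet (Set.range Γ) := hO.mem_nhds hW
  obtain ⟨y, hy1, hy2⟩ := ((hmem.filter_mono nhdsWithin_le_nhds).and
    (self_mem_nhdsWithin (s := Set.Ioi (ψ x)))).exists
  exact not_lt_of_ge ((hcl _).1 (subset_closure hy1)) hy2
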